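/- arXiv:1808.06523 — 2 statements merged into one kernel-verified Lean document; each statement's English description precedes it below -/
import Mathlib

section
/- For all integers d ≥ 2 and n ≥ 2, the number of tuples (p, q, (i_1,…,i_p), (k_1,…,k_q), (j_{q+1},…,j_p)) with 1 ≤ p ≤ n, 1 ≤ q ≤ p, 0 ≤ i_1 < i_2 < ⋯ < i_p ≤ n−1, k_m ∈ {1,…,d−1} for 1 ≤ m ≤ q, 1 ≤ j_{q+1} < ⋯ < j_p ≤ n−1, and i_m ≥ j_m for q < m ≤ p, equals (d−1)·𝔉_{n,n−1}(d) = (d−1)·Σ_{s=0}^{n−1} C(n,s)·d^{n−1−s}. -/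
/-- The `n`-th Catalan number `C_n = binom(2n,n)/(n+1)`. -/
def catalanNum (n : ℕ) : ℕ := (2 * n).choose n / (n + 1)

/-- The Catalan triangle entry `C(n,k) = (n+k)!·(n−k+1)/(k!·(n+1)!)`. -/
def catalanTri (n k : ℕ) : ℕ :=
  ((n + k).factorial * (n - k + 1)) / (k.factorial * (n + 1).factorial)

/-- The Catalan triangle polynomial `𝔉_{n,k}(x) = Σ_{s=0}^k C(n,s)·x^{k−s}`. -/
def catalanTriPoly (n k x : ℕ) : ℕ :=
  ∑ s ∈ Finset.range (k + 1), catalanTri n s * x ^ (k - s)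

/-- The list is strictly increasing with entries in `[a, b)`. -/
def SortedIn (a b : ℕ) (L : List ℕ) : Prop :=
  L.Pairwise (· < ·) ∧ ∀ i ∈ L, a ≤ i ∧ i < b

/-- `I` and `J` are strictly increasing lists in `[a, b)`, `I` has `h` more entries than `J`, and
the last `|J|` entries of `I` dominate `J`. -/
def IsBallotPair (a b h : ℕ) (p : List ℕ × List ℕ) : Prop :=
  SortedIn a b p.1 ∧ SortedIn a b p.2 ∧ h ≤ p.1.length ∧ List.Forall₂ (· ≤ ·) p.2 (p.1.drop h)

/-- The ballot pairs of height `h` with entries in `[a, a + m)`. -/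
def ballotPairs : ℕ → ℕ → ℕ → Finset (List ℕ × List ℕ)
  | 0, _, 0 => {([], [])}
  | 0, _, _ + 1 => ∅
  | m + 1, a, 0 => ballotPairs m (a + 1) 0 ∪
      ((ballotPairs m (a + 1) 0).image (Prod.map (List.cons a) (List.cons a)) ∪
        (ballotPairs m (a + 1) 1).image (Prod.map id (List.cons a)))
  | m + 1, a, h + 1 => (ballotPairs m (a + 1) (h + 1) ∪
      ((ballotPairs m (a + 1) (h + 1)).image (Prod.map (List.cons a) (List.cons a)) ∪
        (ballotPairs m (a + 1) (h + 2)).image (Prod.map id (List.cons a)))) ∪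
      (ballotPairs m (a + 1) h).image (Prod.map (List.cons a) id)

/-- The number of ballot pairs of height `h` with entries in an interval of length `m`. -/
def ballotCount : ℕ → ℕ → ℕ
  | 0, 0 => 1
  | 0, _ + 1 => 0
  | m + 1, 0 => 2 * ballotCount m 0 + ballotCount m 1
  | m + 1, h + 1 => 2 * ballotCount m (h + 1) + ballotCount m (h + 2) + ballotCount m h

/-- The lists of length `h` with entries in `[1, y]`. -/
def boundedLists (y : ℕ) : ℕ → Finset (List ℕ)
  | 0 => {[]}
  | h + 1 => (Finset.Icc 1 y ×ˢ boundedLists y h).image fun p => p.1 :: p.2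

theorem SortedIn.mono {a a' b : ℕ} (h : a' ≤ a) {L : List ℕ} (hL : SortedIn a b L) :
    SortedIn a' b L :=
  ⟨hL.1, fun i hi => ⟨h.trans (hL.2 i hi).1, (hL.2 i hi).2⟩⟩

theorem SortedIn.cons {a b : ℕ} (h : a < b) {L : List ℕ} (hL : SortedIn (a + 1) b L) :
    SortedIn a b (a :: L) := by
  refine ⟨List.pairwise_cons.2 ⟨fun i hi => (hL.2 i hi).1, hL.1⟩, fun i hi => ?_⟩
  rcases List.mem_cons.1 hi with rfl | hi
  · exact ⟨le_rfl, h⟩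
  · exact (hL.mono (Nat.le_succ a)).2 i hi

theorem SortedIn.not_mem {a b : ℕ} {L : List ℕ} (hL : SortedIn (a + 1) b L) : a ∉ L :=
  fun h => absurd (hL.2 a h).1 (by omega)

theorem SortedIn.eq_or_cons {a b : ℕ} {L : List ℕ} (hL : SortedIn a b L) :
    SortedIn (a + 1) b L ∨ ∃ L', L = a :: L' ∧ SortedIn (a + 1) b L' := by
  obtain ⟨h1, h2⟩ := hL
  cases L with
  | nil => exact Or.inl ⟨h1, by simp⟩
  | cons c L =>
    have h3 := List.pairwise_cons.1 h1
    have hc := h2 c (by simp)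
    rcases hc.1.eq_or_lt with rfl | hac
    · exact Or.inr ⟨L, rfl, h3.2, fun i hi => ⟨h3.1 i hi, (h2 i (by simp [hi])).2⟩⟩
    · refine Or.inl ⟨h1, fun i hi => ⟨?_, (h2 i hi).2⟩⟩
      rcases List.mem_cons.1 hi with rfl | hi
      · exact hac
      · exact hac.trans (h3.1 i hi)

theorem List.forall₂_le_cons_of_forall_lt {a : ℕ} {I J : List ℕ} {h : ℕ} (ha : ∀ i ∈ I, a ≤ i) :
    List.Forall₂ (· ≤ ·) (a :: J) (I.drop h) ↔
      h < I.length ∧ List.Forall₂ (· ≤ ·) J (I.drop (h + 1)) := by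
  by_cases hlt : h < I.length
  · rw [List.drop_eq_getElem_cons hlt, List.forall₂_cons]
    simp [hlt, ha _ (List.getElem_mem hlt)]
  · rw [List.drop_eq_nil_of_le (not_lt.1 hlt)]
    simp [hlt]

theorem isBallotPair_cons_cons {a b h : ℕ} (hab : a < b) {I J : List ℕ}
    (hI : SortedIn (a + 1) b I) (hJ : SortedIn (a + 1) b J) :
    IsBallotPair a b h (a :: I, a :: J) ↔ IsBallotPair (a + 1) b h (I, J) := by
  have key : ∀ i ∈ a :: I, a ≤ i := fun i hi => ((hI.cons hab).2 i hi).1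
  simp only [IsBallotPair, hI, hJ, hI.cons hab, hJ.cons hab, true_and,
    List.forall₂_le_cons_of_forall_lt key, List.drop_succ_cons, List.length_cons]
  exact ⟨fun H => ⟨by omega, H.2.2⟩, fun H => ⟨by omega, by omega, H.2⟩⟩

theorem isBallotPair_right_cons {a b h : ℕ} (hab : a < b) {I J : List ℕ}
    (hI : SortedIn (a + 1) b I) (hJ : SortedIn (a + 1) b J) :
    IsBallotPair a b h (I, a :: J) ↔ IsBallotPair (a + 1) b (h + 1) (I, J) := by
  have key : ∀ i ∈ I, a ≤ i := fun i hi => ((hI.mono (Nat.le_succ a)).2 i hi).1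
  simp only [IsBallotPair, hI, hJ, hI.mono (Nat.le_succ a), hJ.cons hab, true_and,
    List.forall₂_le_cons_of_forall_lt key]
  exact ⟨fun H => ⟨by omega, H.2.2⟩, fun H => ⟨by omega, by omega, H.2⟩⟩

theorem isBallotPair_left_cons {a b h : ℕ} (hab : a < b) {I J : List ℕ}
    (hI : SortedIn (a + 1) b I) (hJ : SortedIn (a + 1) b J) :
    IsBallotPair a b (h + 1) (a :: I, J) ↔ IsBallotPair (a + 1) b h (I, J) := by
  simp [IsBallotPair, hI, hJ, hI.cons hab, hJ.mono (Nat.le_succ a)]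

theorem not_isBallotPair_left_cons_zero {a b : ℕ} {I J : List ℕ} (hJ : SortedIn (a + 1) b J) :
    ¬ IsBallotPair a b 0 (a :: I, J) := by
  rintro ⟨-, -, -, h⟩
  obtain ⟨c, J', hc, -, rfl⟩ := List.forall₂_cons_right_iff.1 h
  have := (hJ.2 c (by simp)).1
  omega

theorem isBallotPair_iff_of_sortedIn {a b h : ℕ} {I J : List ℕ}
    (hI : SortedIn (a + 1) b I) (hJ : SortedIn (a + 1) b J) :
    IsBallotPair a b h (I, J) ↔ IsBallotPair (a + 1) b h (I, J) := by
  simp [IsBallotPair, hI, hJ, hI.mono (Nat.le_succ a), hJ.mono (Nat.le_succ a)]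

theorem IsBallotPair.succ_iff {a b h : ℕ} (hab : a < b) (p : List ℕ × List ℕ) :
    IsBallotPair a b h p ↔
      IsBallotPair (a + 1) b h p ∨
      (∃ q, IsBallotPair (a + 1) b h q ∧ Prod.map (List.cons a) (List.cons a) q = p) ∨
      (∃ q, IsBallotPair (a + 1) b (h + 1) q ∧ Prod.map id (List.cons a) q = p) ∨
      (∃ k q, h = k + 1 ∧ IsBallotPair (a + 1) b k q ∧ Prod.map (List.cons a) id q = p) := by
  obtain ⟨I, J⟩ := p
  constructor
  · intro hp
    rcases hp.1.eq_or_cons with hI | ⟨I', hI', hI⟩ <;>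
      rcases hp.2.1.eq_or_cons with hJ | ⟨J', hJ', hJ⟩
    · exact Or.inl ((isBallotPair_iff_of_sortedIn hI hJ).1 hp)
    · obtain rfl : J = a :: J' := hJ'
      exact Or.inr (Or.inr (Or.inl ⟨(I, J'), (isBallotPair_right_cons hab hI hJ).1 hp, rfl⟩))
    · obtain rfl : I = a :: I' := hI'
      cases h with
      | zero => exact absurd hp (not_isBallotPair_left_cons_zero hJ)
      | succ k =>
        exact Or.inr (Or.inr (Or.inr
          ⟨k, (I', J), rfl, (isBallotPair_left_cons hab hI hJ).1 hp, rfl⟩))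
    · obtain rfl : I = a :: I' := hI'
      obtain rfl : J = a :: J' := hJ'
      exact Or.inr (Or.inl ⟨(I', J'), (isBallotPair_cons_cons hab hI hJ).1 hp, rfl⟩)
  · rintro (hp | ⟨q, hq, hqp⟩ | ⟨q, hq, hqp⟩ | ⟨k, q, rfl, hq, hqp⟩)
    · exact (isBallotPair_iff_of_sortedIn hp.1 hp.2.1).2 hp
    · exact hqp ▸ (isBallotPair_cons_cons hab hq.1 hq.2.1).2 hq
    · exact hqp ▸ (isBallotPair_right_cons hab hq.1 hq.2.1).2 hq
    · exact hqp ▸ (isBallotPair_left_cons hab hq.1 hq.2.1).2 hq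

theorem sortedIn_self {a : ℕ} {L : List ℕ} : SortedIn a a L ↔ L = [] := by
  refine ⟨fun h => List.eq_nil_iff_forall_not_mem.2 fun i hi => ?_, ?_⟩
  · have := h.2 i hi
    omega
  · rintro rfl
    exact ⟨List.Pairwise.nil, by simp⟩

theorem mem_ballotPairs (m a h : ℕ) (p : List ℕ × List ℕ) :
    p ∈ ballotPairs m a h ↔ IsBallotPair a (a + m) h p := by
  induction m generalizing a h p with
  | zero =>
    obtain ⟨I, J⟩ := p
    cases h with
    | zero =>
      simp only [ballotPairs, IsBallotPair, Nat.add_zero, sortedIn_self, Finset.mem_singleton,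
        Prod.mk.injEq]
      constructor
      · rintro ⟨rfl, rfl⟩
        simp
      · exact fun h => ⟨h.1, h.2.1⟩
    | succ h =>
      simp only [ballotPairs, IsBallotPair, Nat.add_zero, sortedIn_self, Finset.notMem_empty,
        false_iff]
      rintro ⟨rfl, -, h, -⟩
      simp at h
  | succ m ih =>
    rw [IsBallotPair.succ_iff (by omega)]
    have e : a + (m + 1) = a + 1 + m := by omega
    cases h with
    | zero => simp [ballotPairs, ih, e, -Prod.exists]
    | succ h => simp [ballotPairs, ih, e, -Prod.exists]

theorem not_mem_of_mem_ballotPairs {m a h : ℕ} {p : List ℕ × List ℕ}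
    (hp : p ∈ ballotPairs m (a + 1) h) : a ∉ p.1 ∧ a ∉ p.2 :=
  have h := (mem_ballotPairs _ _ _ _).1 hp
  ⟨h.1.not_mem, h.2.1.not_mem⟩

theorem card_ballotPairs (m a h : ℕ) : (ballotPairs m a h).card = ballotCount m h := by
  induction m generalizing a h with
  | zero => cases h <;> rfl
  | succ m ih =>
    have hc : Function.Injective (List.cons a) := List.cons_injective
    have i1 : Function.Injective (Prod.map (List.cons a) (List.cons a)) := hc.prodMap hc
    have i2 : Function.Injective (Prod.map (id : List ℕ → _) (List.cons a)) :=
      Function.injective_id.prodMap hc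
    have i3 : Function.Injective (Prod.map (List.cons a) (id : List ℕ → _)) :=
      hc.prodMap Function.injective_id
    have d1 (h k l) : Disjoint (ballotPairs m (a + 1) h)
        ((ballotPairs m (a + 1) k).image (Prod.map (List.cons a) (List.cons a)) ∪
        (ballotPairs m (a + 1) l).image (Prod.map id (List.cons a))) := by
      rw [Finset.disjoint_left]
      intro p hp hp'
      apply (not_mem_of_mem_ballotPairs hp).2
      rcases Finset.mem_union.1 hp' with hp' | hp' <;>
        obtain ⟨q, -, rfl⟩ := Finset.mem_image.1 hp' <;> simp
    have d2 (k l) : Disjoint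
        ((ballotPairs m (a + 1) k).image (Prod.map (List.cons a) (List.cons a)))
        ((ballotPairs m (a + 1) l).image (Prod.map id (List.cons a))) := by
      rw [Finset.disjoint_left]
      intro p hp hp'
      obtain ⟨q, -, rfl⟩ := Finset.mem_image.1 hp
      obtain ⟨r, hr, hqr⟩ := Finset.mem_image.1 hp'
      apply (not_mem_of_mem_ballotPairs hr).1
      have := congrArg Prod.fst hqr
      simp only [Prod.map_fst, id] at this
      simp [this]
    have d3 (h k l o) : Disjoint (ballotPairs m (a + 1) h ∪
        ((ballotPairs m (a + 1) k).image (Prod.map (List.cons a) (List.cons a)) ∪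
        (ballotPairs m (a + 1) l).image (Prod.map id (List.cons a))))
        ((ballotPairs m (a + 1) o).image (Prod.map (List.cons a) id)) := by
      rw [Finset.disjoint_right]
      intro p hp hp'
      obtain ⟨r, hr, rfl⟩ := Finset.mem_image.1 hp
      have hr2 := (not_mem_of_mem_ballotPairs hr).2
      rcases Finset.mem_union.1 hp' with hp' | hp'
      · exact (not_mem_of_mem_ballotPairs hp').1 (by simp)
      · rcases Finset.mem_union.1 hp' with hp' | hp' <;>
          obtain ⟨q, -, hq⟩ := Finset.mem_image.1 hp' <;>
          have := congrArg Prod.snd hq <;>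
          simp only [Prod.map_snd, id] at this <;>
          simp [← this] at hr2
    cases h with
    | zero =>
      rw [ballotPairs, Finset.card_union_of_disjoint (d1 _ _ _),
        Finset.card_union_of_disjoint (d2 _ _), Finset.card_image_of_injective _ i1,
        Finset.card_image_of_injective _ i2, ih, ih, ballotCount]
      ring
    | succ h =>
      rw [ballotPairs, Finset.card_union_of_disjoint (d3 _ _ _ _),
        Finset.card_union_of_disjoint (d1 _ _ _),
        Finset.card_union_of_disjoint (d2 _ _), Finset.card_image_of_injective _ i1,
        Finset.card_image_of_injective _ i2, Finset.card_image_of_injective _ i3, ih, ih, ih,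
        ballotCount]
      ring

theorem mem_boundedLists (y h : ℕ) (L : List ℕ) :
    L ∈ boundedLists y h ↔ L.length = h ∧ ∀ k ∈ L, 1 ≤ k ∧ k ≤ y := by
  induction h generalizing L with
  | zero =>
    simp only [boundedLists, Finset.mem_singleton, List.length_eq_zero_iff]
    constructor
    · rintro rfl
      simp
    · exact And.left
  | succ h ih =>
    simp only [boundedLists, Finset.mem_image, Finset.mem_product, Finset.mem_Icc, ih]
    cases L with
    | nil => simp
    | cons c L =>
      simp [Prod.exists]
      tauto

theorem card_boundedLists (y h : ℕ) : (boundedLists y h).card = y ^ h := by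
  induction h with
  | zero => rfl
  | succ h ih =>
    rw [boundedLists, Finset.card_image_of_injective, Finset.card_product, ih, Nat.card_Icc,
      pow_succ', Nat.add_sub_cancel]
    rintro ⟨a, L⟩ ⟨b, M⟩ hab
    simpa using hab

theorem catalanTri_zero (n : ℕ) : catalanTri n 0 = 1 := by
  have : (n + 1).factorial ≠ 0 := Nat.factorial_ne_zero _
  simp only [catalanTri, Nat.factorial_zero, one_mul, Nat.add_zero, Nat.sub_zero]
  rw [mul_comm, ← Nat.factorial_succ]
  exact Nat.div_self (Nat.pos_of_ne_zero this)

theorem catalanTri_succ_add_choose {n k : ℕ} (hk : k < n) :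
    catalanTri n (k + 1) + (n + k + 1).choose k = (n + k + 1).choose (k + 1) := by
  have h1 := Nat.choose_mul_factorial_mul_factorial (show k ≤ n + k + 1 by omega)
  have h2 := Nat.choose_mul_factorial_mul_factorial (show k + 1 ≤ n + k + 1 by omega)
  rw [show n + k + 1 - k = n + 1 by omega] at h1
  rw [show n + k + 1 - (k + 1) = n by omega] at h2
  obtain ⟨r, rfl⟩ := Nat.exists_eq_add_of_lt hk
  have hpos : 0 < (k + 1).factorial * (k + r + 1 + 1).factorial := by positivity
  set N := k + r + 1 + k + 1
  have hle : N.choose k ≤ N.choose (k + 1) :=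
    Nat.choose_le_succ_of_lt_half_left (by omega)
  obtain ⟨e, he⟩ := Nat.exists_eq_add_of_le hle
  have hmul : N.factorial * (k + r + 1 - (k + 1) + 1) =
      (k + 1).factorial * (k + r + 1 + 1).factorial * e := by
    rw [show k + r + 1 - (k + 1) + 1 = r + 1 by omega]
    rw [he] at h2
    rw [Nat.factorial_succ (k + r + 1)] at h1 ⊢
    rw [Nat.factorial_succ k] at h2 ⊢
    zify at h1 h2 ⊢
    linear_combination (-(k + 1 : ℤ)) * h1 * (-1) - h2 * (k + r + 2)
  rw [catalanTri, show k + r + 1 + (k + 1) = N by omega, hmul, Nat.mul_div_cancel_left _ hpos, he,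
    add_comm]

theorem catalanTri_pascal {n k : ℕ} (hk : k < n) :
    catalanTri (n + 1) (k + 1) = catalanTri (n + 1) k + catalanTri n (k + 1) := by
  have h1 := catalanTri_succ_add_choose (show k < n + 1 by omega)
  have h2 := catalanTri_succ_add_choose hk
  cases k with
  | zero =>
    rw [catalanTri_zero]
    simp only [Nat.zero_add, Nat.add_zero, Nat.choose_zero_right, Nat.choose_one_right] at h1 h2 ⊢
    omega
  | succ k =>
    have h3 := catalanTri_succ_add_choose (show k < n + 1 by omega)
    rw [show n + 1 + (k + 1) + 1 = (n + k + 2) + 1 by ring, Nat.choose_succ_succ' _ k,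
      Nat.choose_succ_succ' _ (k + 1)] at h1
    rw [show n + (k + 1) + 1 = n + k + 2 by ring] at h2
    rw [show n + 1 + k + 1 = n + k + 2 by ring] at h3
    omega

theorem catalanTri_diag (n : ℕ) : catalanTri (n + 1) (n + 1) = catalanTri (n + 1) n := by
  rw [catalanTri, catalanTri]
  have h1 : (n + 1 + (n + 1)).factorial * (n + 1 - (n + 1) + 1) =
      (n + 1) * ((n + 1 + n).factorial * (n + 1 - n + 1)) := by
    rw [show n + 1 + (n + 1) = (n + 1 + n) + 1 by ring, Nat.factorial_succ]
    simp only [Nat.sub_self, Nat.add_sub_cancel_left]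
    ring
  rw [h1, Nat.factorial_succ n, mul_assoc, Nat.mul_div_mul_left _ _ (Nat.succ_pos n)]

theorem ballotCount_eq_zero {m h : ℕ} (hm : m < h) : ballotCount m h = 0 := by
  induction m generalizing h with
  | zero =>
    obtain ⟨h, rfl⟩ := Nat.exists_eq_add_of_lt hm
    simp [ballotCount]
  | succ m ih =>
    cases h with
    | zero => omega
    | succ h => simp [ballotCount, ih (show m < h by omega), ih (show m < h + 1 by omega),
        ih (show m < h + 2 by omega)]

theorem ballotCount_add (h k : ℕ) : ballotCount (h + k) h = catalanTri (2 * h + k + 1) k := by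
  generalize hm : h + k = m
  induction m generalizing h k with
  | zero =>
    obtain ⟨rfl, rfl⟩ : h = 0 ∧ k = 0 := by omega
    simp [ballotCount, catalanTri_zero]
  | succ m ih =>
    match h, k with
    | 0, 0 => omega
    | 0, 1 =>
      obtain rfl : m = 0 := by omega
      simp [ballotCount, catalanTri_pascal, catalanTri_zero, catalanTri_diag]
    | 0, k + 2 =>
      have h1 := catalanTri_pascal (show k + 1 < k + 2 by omega)
      have h2 := catalanTri_pascal (show k < k + 2 by omega)
      have h3 := catalanTri_diag (k + 1)
      have e1 : 2 * 0 + (k + 1) + 1 = k + 2 := by ring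
      have e2 : 2 * 1 + k + 1 = k + 2 + 1 := by ring
      have e3 : 2 * 0 + (k + 2) + 1 = k + 2 + 1 := by ring
      rw [ballotCount, ih 0 (k + 1) (by omega), ih 1 k (by omega), e1, e2, e3]
      simp only [Nat.add_assoc, Nat.reduceAdd] at h1 h2 h3 ⊢
      omega
    | h + 1, 0 =>
      rw [ballotCount, ih h 0 (by omega), ballotCount_eq_zero (by omega),
        ballotCount_eq_zero (by omega)]
      simp [catalanTri_zero]
    | h + 1, 1 =>
      have h1 := catalanTri_pascal (show 0 < 2 * h + 2 + 1 by omega)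
      have h2 := catalanTri_pascal (show 0 < 2 * h + 2 by omega)
      have e3 : 2 * (h + 1) + 1 + 1 = 2 * h + 2 + 1 + 1 := by ring
      rw [ballotCount, ih h 1 (by omega), ih (h + 1) 0 (by omega), ballotCount_eq_zero (by omega),
        e3]
      simp only [catalanTri_zero, Nat.zero_add, Nat.add_assoc, Nat.reduceAdd] at h1 h2 ⊢
      omega
    | h + 1, k + 2 =>
      have h1 := catalanTri_pascal (show k + 1 < 2 * h + k + 4 by omega)
      have h2 := catalanTri_pascal (show k < 2 * h + k + 4 by omega)
      have h3 := catalanTri_pascal (show k + 1 < 2 * h + k + 3 by omega)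
      have e1 : 2 * h + (k + 2) + 1 = 2 * h + k + 3 := by ring
      have e2 : 2 * (h + 1) + (k + 1) + 1 = 2 * h + k + 4 := by ring
      have e3 : 2 * (h + 2) + k + 1 = 2 * h + k + 4 + 1 := by ring
      have e4 : 2 * (h + 1) + (k + 2) + 1 = 2 * h + k + 4 + 1 := by ring
      rw [ballotCount, ih h (k + 2) (by omega), ih (h + 1) (k + 1) (by omega),
        ih (h + 2) k (by omega), e1, e2, e3, e4]
      simp only [Nat.add_assoc, Nat.reduceAdd] at h1 h2 h3 ⊢
      omega

theorem catalanTriPoly_succ (n k x : ℕ) :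
    catalanTriPoly n (k + 1) x = x * catalanTriPoly n k x + catalanTri n (k + 1) := by
  rw [catalanTriPoly, Finset.sum_range_succ, catalanTriPoly, Finset.mul_sum, Nat.sub_self,
    pow_zero, mul_one]
  congr 1
  refine Finset.sum_congr rfl fun s hs => ?_
  rw [Nat.succ_sub (Nat.lt_succ_iff.1 (Finset.mem_range.1 hs)), pow_succ]
  ring

theorem mul_catalanTriPoly_add {m k : ℕ} (hk : k ≤ m) (y : ℕ) :
    y * catalanTriPoly (m + 1) k (y + 1) + catalanTri (m + 1) k =
      (y + 1) * catalanTriPoly m k (y + 1) := by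
  induction k with
  | zero => simp [catalanTriPoly, catalanTri_zero]
  | succ k ih =>
    rw [catalanTriPoly_succ, catalanTriPoly_succ, catalanTri_pascal (by omega)]
    linear_combination (y + 1) * ih (by omega)

/-- The generating function of ballot pairs by height. -/
theorem sum_ballotCount_mul_pow_succ (m y : ℕ) :
    y * ∑ h ∈ Finset.range (m + 2), ballotCount (m + 1) h * y ^ h + ballotCount m 0 =
      (y + 1) ^ 2 * ∑ h ∈ Finset.range (m + 1), ballotCount m h * y ^ h := by
  set g : ℕ → ℕ := fun h => ballotCount m h * y ^ h with hg
  have e1 : ∑ h ∈ Finset.range (m + 1), g h = ∑ h ∈ Finset.range (m + 1), g (h + 1) + g 0 := by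
    rw [← Finset.sum_range_succ', Finset.sum_range_succ g (m + 1)]
    simp [hg, ballotCount_eq_zero]
  have e2 : ∑ h ∈ Finset.range (m + 1), g h =
      ∑ h ∈ Finset.range (m + 1), g (h + 2) + g 1 + g 0 := by
    rw [e1, ← Finset.sum_range_succ' (fun h => g (h + 1)),
      Finset.sum_range_succ (fun h => g (h + 1)) (m + 1)]
    simp [hg, ballotCount_eq_zero]
  have e3 : y * ∑ h ∈ Finset.range (m + 1), ballotCount (m + 1) (h + 1) * y ^ (h + 1) =
      2 * y * ∑ h ∈ Finset.range (m + 1), g (h + 1) + ∑ h ∈ Finset.range (m + 1), g (h + 2) +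
        y ^ 2 * ∑ h ∈ Finset.range (m + 1), g h := by
    simp only [Finset.mul_sum, ← Finset.sum_add_distrib]
    refine Finset.sum_congr rfl fun h _ => ?_
    simp only [hg, ballotCount]
    ring
  rw [Finset.sum_range_succ', mul_add, e3, ballotCount]
  have g0 : g 0 = ballotCount m 0 := by simp [hg]
  have g1 : g 1 = ballotCount m 1 * y := by simp [hg]
  rw [g0] at e1 e2
  rw [g1] at e2
  zify at e1 e2 ⊢
  linear_combination (-2 * y : ℤ) * e1 - e2

theorem ballotCount_zero_right (m : ℕ) : ballotCount m 0 = catalanTri (m + 1) (m + 1) := by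
  have := ballotCount_add 0 m
  rw [catalanTri_diag]
  simpa using this

theorem sum_ballotCount_mul_pow (m : ℕ) {y : ℕ} (hy : 0 < y) :
    ∑ h ∈ Finset.range (m + 1), ballotCount m h * y ^ h = catalanTriPoly m m (y + 1) := by
  induction m with
  | zero => simp [catalanTriPoly, catalanTri_zero, ballotCount]
  | succ m ih =>
    have h1 := sum_ballotCount_mul_pow_succ m y
    have h2 := mul_catalanTriPoly_add (le_refl m) y
    have h3 := catalanTriPoly_succ (m + 1) m (y + 1)
    rw [ih, ballotCount_zero_right] at h1
    rw [← catalanTri_diag] at h2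
    refine Nat.eq_of_mul_eq_mul_left hy (Nat.add_right_cancel (h1.trans ?_))
    · rw [h3, pow_two, mul_assoc, ← h2]
      ring

/-- The ballot pairs `(I, J)` of height `h + 1` with `I` in `[0, m]` and `J` in `[1, m]`. -/
def extendedPairs (m h : ℕ) : Finset (List ℕ × List ℕ) :=
  ballotPairs m 1 (h + 1) ∪ (ballotPairs m 1 h).image (Prod.map (List.cons 0) id)

theorem mem_extendedPairs (m h : ℕ) (p : List ℕ × List ℕ) :
    p ∈ extendedPairs m h ↔ SortedIn 0 (m + 1) p.1 ∧ SortedIn 1 (m + 1) p.2 ∧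
      h + 1 ≤ p.1.length ∧ List.Forall₂ (· ≤ ·) p.2 (p.1.drop (h + 1)) := by
  obtain ⟨I, J⟩ := p
  simp only [extendedPairs, Finset.mem_union, Finset.mem_image, mem_ballotPairs,
    Nat.add_comm 1 m]
  constructor
  · rintro (hp | ⟨q, hq, hqp⟩)
    · exact ⟨hp.1.mono (by omega), hp.2⟩
    · obtain ⟨rfl, rfl⟩ := Prod.mk.inj hqp
      exact ⟨hq.1.cons (by omega), hq.2.1, by simpa using hq.2.2.1, hq.2.2.2⟩
  · rintro ⟨hI, hJ, hl, hf⟩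
    rcases hI.eq_or_cons with hI' | ⟨I', rfl, hI'⟩
    · exact Or.inl ⟨hI', hJ, hl, hf⟩
    · exact Or.inr ⟨(I', J), ⟨hI', hJ, by simpa using hl, hf⟩, rfl⟩

theorem card_extendedPairs (m h : ℕ) :
    (extendedPairs m h).card = ballotCount m (h + 1) + ballotCount m h := by
  rw [extendedPairs, Finset.card_union_of_disjoint, Finset.card_image_of_injective,
    card_ballotPairs, card_ballotPairs]
  · exact List.cons_injective.prodMap Function.injective_id
  · rw [Finset.disjoint_right]
    intro p hp hp'
    obtain ⟨q, -, rfl⟩ := Finset.mem_image.1 hp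
    exact (not_mem_of_mem_ballotPairs hp').1 (by simp)

theorem sum_card_extendedPairs (m : ℕ) {y : ℕ} (hy : 0 < y) :
    ∑ h ∈ Finset.range (m + 1), y ^ (h + 1) * (ballotCount m (h + 1) + ballotCount m h) =
      y * catalanTriPoly (m + 1) m (y + 1) := by
  have h1 := sum_ballotCount_mul_pow m hy
  have h2 := mul_catalanTriPoly_add (le_refl m) y
  rw [← catalanTri_diag, ← ballotCount_zero_right, ← h1] at h2
  have e1 : ∑ h ∈ Finset.range (m + 1), ballotCount m h * y ^ h =
      ∑ h ∈ Finset.range (m + 1), ballotCount m (h + 1) * y ^ (h + 1) + ballotCount m 0 := by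
    have := Finset.sum_range_succ' (fun h => ballotCount m h * y ^ h) (m + 1)
    rw [Finset.sum_range_succ] at this
    simpa [ballotCount_eq_zero] using this
  have e2 : ∑ h ∈ Finset.range (m + 1), y ^ (h + 1) * (ballotCount m (h + 1) + ballotCount m h) =
      ∑ h ∈ Finset.range (m + 1), ballotCount m (h + 1) * y ^ (h + 1) +
        y * ∑ h ∈ Finset.range (m + 1), ballotCount m h * y ^ h := by
    rw [Finset.mul_sum, ← Finset.sum_add_distrib]
    exact Finset.sum_congr rfl fun h _ => by ring
  rw [e2]
  zify at e1 h2 ⊢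
  linear_combination -h2 - e1

/-- The encoded tuples, sorted by the length of the middle list. -/
def typeIITuples (m y : ℕ) : Finset (List ℕ × List ℕ × List ℕ) :=
  (Finset.range (m + 1)).biUnion fun h =>
    (boundedLists y (h + 1) ×ˢ extendedPairs m h).image fun p => (p.2.1, p.1, p.2.2)

theorem mem_typeIITuples (m y : ℕ) (x : List ℕ × List ℕ × List ℕ) :
    x ∈ typeIITuples m y ↔ ∃ h < m + 1, x.2.1 ∈ boundedLists y (h + 1) ∧
      (x.1, x.2.2) ∈ extendedPairs m h := by
  obtain ⟨I, K, J⟩ := x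
  simp only [typeIITuples, Finset.mem_biUnion, Finset.mem_range, Finset.mem_image,
    Finset.mem_product]
  refine exists_congr fun h => and_congr_right fun _ => ⟨?_, fun hx => ⟨(K, I, J), hx, rfl⟩⟩
  rintro ⟨⟨K, I, J⟩, hp, hx⟩
  simp only [Prod.mk.injEq] at hx
  obtain ⟨rfl, rfl, rfl⟩ := hx
  exact hp

theorem card_typeIITuples (m : ℕ) {y : ℕ} (hy : 0 < y) :
    (typeIITuples m y).card = y * catalanTriPoly (m + 1) m (y + 1) := by
  rw [typeIITuples, Finset.card_biUnion, ← sum_card_extendedPairs m hy]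
  · refine Finset.sum_congr rfl fun h _ => ?_
    rw [Finset.card_image_of_injective, Finset.card_product, card_boundedLists,
      card_extendedPairs]
    rintro ⟨K, I, J⟩ ⟨K', I', J'⟩ h
    simp only [Prod.mk.injEq] at h ⊢
    tauto
  · intro h _ k _ hhk
    refine Finset.disjoint_left.2 ?_
    intro x hx hx'
    obtain ⟨p, hp, rfl⟩ := Finset.mem_image.1 hx
    obtain ⟨q, hq, hqp⟩ := Finset.mem_image.1 hx'
    have hp := ((mem_boundedLists _ _ _).1 (Finset.mem_product.1 hp).1).1
    have hq := ((mem_boundedLists _ _ _).1 (Finset.mem_product.1 hq).1).1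
    simp only [Prod.mk.injEq] at hqp
    rw [hqp.2.1] at hq
    omega

theorem SortedIn.length_le {a b : ℕ} {L : List ℕ} (hL : SortedIn a b L) : L.length ≤ b - a := by
  have hnd : L.Nodup := hL.1.imp fun h => h.ne
  rw [← List.toFinset_card_of_nodup hnd, ← Nat.card_Ico]
  exact Finset.card_le_card fun i hi => Finset.mem_Ico.2 (hL.2 i (List.mem_toFinset.1 hi))

/-- For `d ≥ 2`, `n ≥ 2`, the number of tuples `(p,q,(i_1,…,i_p),(k_1,…,k_q),
(j_{q+1},…,j_p))` with `1 ≤ q ≤ p ≤ n`, `0 ≤ i_1 < ⋯ < i_p ≤ n−1`,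
`k_m ∈ {1,…,d−1}`, `1 ≤ j_{q+1} < ⋯ < j_p ≤ n−1` and `i_m ≥ j_m` for `q < m ≤ p`,
equals `(d−1)·𝔉_{n,n−1}(d)`.  (The tuple is encoded as the triple of lists
`(I,K,J)` with `p = |I|`, `q = |K|` and `|J| = p − q`.) -/
theorem card_type_II_monomials (d n : ℕ) (hd : 2 ≤ d) (hn : 2 ≤ n) :
    Nat.card {x : List ℕ × List ℕ × List ℕ //
      1 ≤ x.1.length ∧ x.1.length ≤ n ∧
      1 ≤ x.2.1.length ∧ x.2.1.length ≤ x.1.length ∧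
      x.2.2.length = x.1.length - x.2.1.length ∧
      x.1.Chain' (· < ·) ∧ (∀ i ∈ x.1, i ≤ n - 1) ∧
      (∀ k ∈ x.2.1, 1 ≤ k ∧ k ≤ d - 1) ∧
      x.2.2.Chain' (· < ·) ∧ (∀ j ∈ x.2.2, 1 ≤ j ∧ j ≤ n - 1) ∧
      (∀ (t : ℕ) (h1 : t < x.2.2.length) (h2 : x.2.1.length + t < x.1.length),
        x.2.2.get ⟨t, h1⟩ ≤ x.1.get ⟨x.2.1.length + t, h2⟩)} =
    (d - 1) * catalanTriPoly n (n - 1) d := by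
  obtain ⟨m, rfl⟩ : ∃ m, n = m + 1 := ⟨n - 1, by omega⟩
  obtain ⟨y, rfl⟩ : ∃ y, d = y + 1 := ⟨d - 1, by omega⟩
  simp only [Nat.add_sub_cancel]
  rw [← card_typeIITuples m (show 0 < y by omega)]
  refine Nat.subtype_card _ fun x => ?_
  obtain ⟨I, K, J⟩ := x
  simp only [mem_typeIITuples, mem_boundedLists, mem_extendedPairs, List.forall₂_iff_get,
    List.length_drop, List.get_eq_getElem, List.getElem_drop]
  constructor
  · rintro ⟨h, hh, ⟨hK, hKb⟩, hI, hJ, hl, hlen, hf⟩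
    have := hI.length_le
    refine ⟨by omega, by omega, by omega, by omega, by omega, hI.1.isChain,
      fun i hi => Nat.lt_succ_iff.1 (hI.2 i hi).2, hKb, hJ.1.isChain,
      fun j hj => ⟨(hJ.2 j hj).1, Nat.lt_succ_iff.1 (hJ.2 j hj).2⟩, fun t h1 h2 => ?_⟩
    simp only [hK]
    exact hf t h1 (by omega)
  · rintro ⟨-, hIl, hK1, hKI, hlen, hI, hIb, hKb, hJ, hJb, hf⟩
    obtain ⟨h, hK⟩ : ∃ h, K.length = h + 1 := ⟨K.length - 1, by omega⟩
    simp only [hK] at *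
    exact ⟨h, by omega, ⟨rfl, hKb⟩, ⟨List.isChain_iff_pairwise.1 hI, fun i hi => ⟨by omega, Nat.lt_succ_iff.2 (hIb i hi)⟩⟩,
      ⟨List.isChain_iff_pairwise.1 hJ, fun j hj => ⟨(hJb j hj).1, Nat.lt_succ_iff.2 (hJb j hj).2⟩⟩, hKI, hlen,
      fun t h1 h2 => hf t h1 (by omega)⟩
end

section
/- For all integers d ≥ 2 and n ≥ 2, the number of tuples (p, k, (i_1,…,i_p), (j_1,…,j_p)) with 1 ≤ p ≤ n−1, 1 ≤ k ≤ d−1, 1 ≤ i_1 < ⋯ < i_p ≤ n−1, 1 ≤ j_1 < ⋯ < j_p ≤ n−1, and i_m ≥ j_m for all 1 ≤ m ≤ p, equals (d−1)·(C_n − 1). -/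
/-- Pairs `(I, J)` of strictly increasing lists with entries in `[a, a + N)`,
`I.length = J.length + h` and `J[m] ≤ I[m + h]`, built according to whether `a` lies in `I`
and in `J`. -/
def dominatedPairs : ℕ → ℕ → ℕ → Finset (List ℕ × List ℕ)
  | 0, _, 0 => {([], [])}
  | 0, _, _ + 1 => ∅
  | N + 1, a, 0 =>
      (dominatedPairs N (a + 1) 0 ∪
        (dominatedPairs N (a + 1) 0).image (fun x => (a :: x.1, a :: x.2))) ∪
        (dominatedPairs N (a + 1) 1).image (fun x => (x.1, a :: x.2))
  | N + 1, a, h + 1 =>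
      ((dominatedPairs N (a + 1) (h + 1) ∪
        (dominatedPairs N (a + 1) (h + 1)).image (fun x => (a :: x.1, a :: x.2))) ∪
        (dominatedPairs N (a + 1) (h + 2)).image (fun x => (x.1, a :: x.2))) ∪
        (dominatedPairs N (a + 1) h).image (fun x => (a :: x.1, x.2))

/-- The defining property of the members of `dominatedPairs N a h`. -/
def IsDominatedPair (N a h : ℕ) (x : List ℕ × List ℕ) : Prop :=
  x.1.Pairwise (· < ·) ∧ x.2.Pairwise (· < ·) ∧
    (∀ i ∈ x.1, a ≤ i ∧ i < a + N) ∧ (∀ j ∈ x.2, a ≤ j ∧ j < a + N) ∧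
    x.1.length = x.2.length + h ∧
    ∀ (m : ℕ) (h2 : m < x.2.length) (h1 : m + h < x.1.length), x.2[m] ≤ x.1[m + h]

/-- A strictly increasing list bounded below by `a` either starts with `a` or is bounded below
by `a + 1`. -/
theorem List.Pairwise.eq_cons_or_forall_succ_le {l : List ℕ} {a N : ℕ}
    (hl : l.Pairwise (· < ·)) (ha : ∀ i ∈ l, a ≤ i ∧ i < a + (N + 1)) :
    (∃ t : List ℕ, l = a :: t ∧ t.Pairwise (· < ·) ∧ ∀ i ∈ t, a + 1 ≤ i ∧ i < a + 1 + N) ∨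
      ∀ i ∈ l, a + 1 ≤ i ∧ i < a + 1 + N := by
  cases l with
  | nil => right; simp
  | cons b t =>
    rw [List.pairwise_cons] at hl
    have hb := ha b (by simp)
    by_cases hab : b = a
    · subst hab
      refine Or.inl ⟨t, rfl, hl.2, fun i hi => ?_⟩
      have := hl.1 i hi
      have := ha i (by simp [hi])
      omega
    · right
      intro i hi
      have h1 := ha i hi
      rcases List.mem_cons.1 hi with rfl | hi
      · omega
      · have := hl.1 i hi
        omega

theorem pairwise_cons_of_forall_succ_le {t : List ℕ} {a N : ℕ} (ht : t.Pairwise (· < ·))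
    (hb : ∀ i ∈ t, a + 1 ≤ i ∧ i < a + 1 + N) : (a :: t).Pairwise (· < ·) :=
  List.pairwise_cons.2 ⟨fun i hi => (hb i hi).1, ht⟩

theorem forall_mem_cons_bounds {t : List ℕ} {a N : ℕ}
    (hb : ∀ i ∈ t, a + 1 ≤ i ∧ i < a + 1 + N) : ∀ i ∈ a :: t, a ≤ i ∧ i < a + (N + 1) := by
  intro i hi
  rcases List.mem_cons.1 hi with rfl | hi
  · omega
  · have := hb i hi
    omega

theorem forall_mem_bounds_weaken {t : List ℕ} {a N : ℕ}
    (hb : ∀ i ∈ t, a + 1 ≤ i ∧ i < a + 1 + N) : ∀ i ∈ t, a ≤ i ∧ i < a + (N + 1) :=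
  fun i hi => forall_mem_cons_bounds hb i (List.mem_cons_of_mem a hi)

namespace IsDominatedPair

variable {N a h : ℕ} {I J : List ℕ}

theorem weaken (H : IsDominatedPair N (a + 1) h (I, J)) : IsDominatedPair (N + 1) a h (I, J) :=
  ⟨H.1, H.2.1, forall_mem_bounds_weaken H.2.2.1, forall_mem_bounds_weaken H.2.2.2.1, H.2.2.2.2⟩

theorem cons_cons (H : IsDominatedPair N (a + 1) h (I, J)) :
    IsDominatedPair (N + 1) a h (a :: I, a :: J) := by
  obtain ⟨hI, hJ, bI, bJ, hl, hd⟩ := H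
  refine ⟨pairwise_cons_of_forall_succ_le hI bI, pairwise_cons_of_forall_succ_le hJ bJ,
    forall_mem_cons_bounds bI, forall_mem_cons_bounds bJ, by simp at hl ⊢; omega, ?_⟩
  rintro (_ | m) h2 h1
  · exact (forall_mem_cons_bounds bI _ (List.getElem_mem h1)).1
  · simp only [List.length_cons] at h1 h2
    have := hd m (by simpa using h2) (by simp only; omega)
    simpa [Nat.add_right_comm m 1 h] using this

theorem cons_right (H : IsDominatedPair N (a + 1) (h + 1) (I, J)) :
    IsDominatedPair (N + 1) a h (I, a :: J) := by
  obtain ⟨hI, hJ, bI, bJ, hl, hd⟩ := H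
  refine ⟨hI, pairwise_cons_of_forall_succ_le hJ bJ,
    forall_mem_bounds_weaken bI, forall_mem_cons_bounds bJ, by simp at hl ⊢; omega, ?_⟩
  rintro (_ | m) h2 h1
  · exact (forall_mem_bounds_weaken bI _ (List.getElem_mem h1)).1
  · simp only [List.length_cons] at h1 h2
    have := hd m (by simpa using h2) (by simp only; omega)
    simpa [Nat.add_right_comm m 1 h, Nat.add_assoc] using this

theorem cons_left (H : IsDominatedPair N (a + 1) h (I, J)) :
    IsDominatedPair (N + 1) a (h + 1) (a :: I, J) := by
  obtain ⟨hI, hJ, bI, bJ, hl, hd⟩ := H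
  refine ⟨pairwise_cons_of_forall_succ_le hI bI, hJ,
    forall_mem_cons_bounds bI, forall_mem_bounds_weaken bJ, by simp at hl ⊢; omega, ?_⟩
  intro m h2 h1
  simp only [List.length_cons] at h1 h2
  have := hd m h2 (by simp only; omega)
  simpa [← Nat.add_assoc] using this

/-- Every dominated pair over `[a, a + N + 1)` arises from one over `[a + 1, a + N + 1)`. -/
theorem cases_succ (H : IsDominatedPair (N + 1) a h (I, J)) :
    IsDominatedPair N (a + 1) h (I, J) ∨
    (∃ I' J', IsDominatedPair N (a + 1) h (I', J') ∧ I = a :: I' ∧ J = a :: J') ∨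
    (∃ J', IsDominatedPair N (a + 1) (h + 1) (I, J') ∧ J = a :: J') ∨
    ∃ I' k, h = k + 1 ∧ IsDominatedPair N (a + 1) k (I', J) ∧ I = a :: I' := by
  obtain ⟨hI, hJ, bI, bJ, hl, hd⟩ := H
  simp only at hI hJ bI bJ hl hd
  rcases hI.eq_cons_or_forall_succ_le bI with ⟨I', rfl, hI', bI'⟩ | bI' <;>
  rcases hJ.eq_cons_or_forall_succ_le bJ with ⟨J', rfl, hJ', bJ'⟩ | bJ'
  · refine Or.inr (Or.inl ⟨I', J', ⟨hI', hJ', bI', bJ', by simp at hl ⊢; omega, ?_⟩, rfl, rfl⟩)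
    intro m h2 h1
    have := hd (m + 1) (by simpa using h2) (by simp at h1 ⊢; omega)
    simpa [Nat.add_right_comm m 1 h] using this
  · refine Or.inr (Or.inr (Or.inr ?_))
    cases h with
    | zero =>
      simp only [List.length_cons] at hl
      have h0 : 0 < J.length := by omega
      have h1 := hd 0 h0 (by simp)
      have h2 := bJ' _ (List.getElem_mem h0)
      simp at h1
      omega
    | succ k =>
      refine ⟨I', k, rfl, ⟨hI', hJ, bI', bJ', by simp at hl ⊢; omega, ?_⟩, rfl⟩
      intro m h2 h1
      have := hd m h2 (by simp at h1 ⊢; omega)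
      simpa [← Nat.add_assoc] using this
  · refine Or.inr (Or.inr (Or.inl ⟨J', ⟨hI, hJ', bI', bJ', by simp at hl ⊢; omega, ?_⟩, rfl⟩))
    intro m h2 h1
    have := hd (m + 1) (by simpa using h2) (by simp at h1 ⊢; omega)
    simpa [Nat.add_right_comm m 1 h, Nat.add_assoc] using this
  · exact Or.inl ⟨hI, hJ, bI', bJ', hl, hd⟩

end IsDominatedPair

theorem mem_dominatedPairs {N a h : ℕ} {x : List ℕ × List ℕ} :
    x ∈ dominatedPairs N a h ↔ IsDominatedPair N a h x := by
  obtain ⟨I, J⟩ := x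
  induction N generalizing a h I J with
  | zero =>
    have key : IsDominatedPair 0 a h (I, J) ↔ h = 0 ∧ I = [] ∧ J = [] := by
      constructor
      · rintro ⟨-, -, bI, bJ, hl, -⟩
        have hI : I = [] := List.eq_nil_iff_forall_not_mem.2 fun i hi => by
          have := bI i hi
          omega
        have hJ : J = [] := List.eq_nil_iff_forall_not_mem.2 fun i hi => by
          have := bJ i hi
          omega
        subst hI hJ
        simp at hl
        exact ⟨hl.symm, rfl, rfl⟩
      · rintro ⟨rfl, rfl, rfl⟩
        simp [IsDominatedPair]
    rw [key]
    cases h <;> simp [dominatedPairs]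
  | succ N ih =>
    constructor
    · intro hx
      cases h <;>
        simp only [dominatedPairs, Finset.mem_union, Finset.mem_image, Prod.exists,
          Prod.mk.injEq] at hx
      · rcases hx with (hx | ⟨I', J', hx, rfl, rfl⟩) | ⟨I', J', hx, rfl, rfl⟩
        · exact ((ih _ _).1 hx).weaken
        · exact ((ih _ _).1 hx).cons_cons
        · exact ((ih _ _).1 hx).cons_right
      · rcases hx with ((hx | ⟨I', J', hx, rfl, rfl⟩) | ⟨I', J', hx, rfl, rfl⟩) |
          ⟨I', J', hx, rfl, rfl⟩
        · exact ((ih _ _).1 hx).weaken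
        · exact ((ih _ _).1 hx).cons_cons
        · exact ((ih _ _).1 hx).cons_right
        · exact ((ih _ _).1 hx).cons_left
    · intro H
      rcases H.cases_succ with H' | ⟨I', J', H', rfl, rfl⟩ | ⟨J', H', rfl⟩ | ⟨I', k, rfl, H', rfl⟩
      · have := (ih _ _).2 H'
        cases h <;> simp [dominatedPairs, this]
      · have := (ih _ _).2 H'
        cases h <;> simp [dominatedPairs, this]
      · have := (ih _ _).2 H'
        cases h <;> simp_all [dominatedPairs]
      · have := (ih _ _).2 H'
        simp [dominatedPairs, this]

theorem cons_fst_notMem_dominatedPairs (N a h : ℕ) (I J : List ℕ) :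
    (a :: I, J) ∉ dominatedPairs N (a + 1) h := fun hx => by
  have := (mem_dominatedPairs.1 hx).2.2.1 a (by simp)
  omega

theorem cons_snd_notMem_dominatedPairs (N a h : ℕ) (I J : List ℕ) :
    (I, a :: J) ∉ dominatedPairs N (a + 1) h := fun hx => by
  have := (mem_dominatedPairs.1 hx).2.2.2.1 a (by simp)
  omega

theorem card_dominatedPairs_succ_zero (N a : ℕ) :
    (dominatedPairs (N + 1) a 0).card =
      2 * (dominatedPairs N (a + 1) 0).card + (dominatedPairs N (a + 1) 1).card := by
  rw [dominatedPairs, Finset.card_union_of_disjoint, Finset.card_union_of_disjoint,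
    Finset.card_image_of_injective, Finset.card_image_of_injective]
  · ring
  · rintro ⟨_, _⟩ ⟨_, _⟩; simp
  · rintro ⟨_, _⟩ ⟨_, _⟩; simp
  all_goals
    rw [Finset.disjoint_left]
    rintro ⟨I, J⟩ h1 h2
    simp only [Finset.mem_union, Finset.mem_image, Prod.exists, Prod.mk.injEq] at h1 h2
    grind [cons_fst_notMem_dominatedPairs, cons_snd_notMem_dominatedPairs]

theorem card_dominatedPairs_succ_succ (N a h : ℕ) :
    (dominatedPairs (N + 1) a (h + 1)).card =
      2 * (dominatedPairs N (a + 1) (h + 1)).card + (dominatedPairs N (a + 1) (h + 2)).card +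
        (dominatedPairs N (a + 1) h).card := by
  rw [dominatedPairs, Finset.card_union_of_disjoint, Finset.card_union_of_disjoint,
    Finset.card_union_of_disjoint, Finset.card_image_of_injective,
    Finset.card_image_of_injective, Finset.card_image_of_injective]
  · ring
  · rintro ⟨_, _⟩ ⟨_, _⟩; simp
  · rintro ⟨_, _⟩ ⟨_, _⟩; simp
  · rintro ⟨_, _⟩ ⟨_, _⟩; simp
  all_goals
    rw [Finset.disjoint_left]
    rintro ⟨I, J⟩ h1 h2
    simp only [Finset.mem_union, Finset.mem_image, Prod.exists, Prod.mk.injEq] at h1 h2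
    grind [cons_fst_notMem_dominatedPairs, cons_snd_notMem_dominatedPairs]

theorem Nat.choose_add_two_add_two (n k : ℕ) :
    (n + 2).choose (k + 2) = n.choose k + 2 * n.choose (k + 1) + n.choose (k + 2) := by
  rw [Nat.choose_succ_succ' (n + 1), Nat.choose_succ_succ' n, Nat.choose_succ_succ' n]
  ring

theorem card_dominatedPairs_add (N a h : ℕ) :
    (dominatedPairs N a h).card + (2 * N + 1).choose (N + h + 2) =
      (2 * N + 1).choose (N + h + 1) := by
  induction N generalizing a h with
  | zero =>
    cases h with
    | zero => simp [dominatedPairs]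
    | succ h => simp [dominatedPairs, Nat.choose_eq_zero_of_lt]
  | succ N ih =>
    have e : 2 * (N + 1) + 1 = 2 * N + 1 + 2 := by ring
    cases h with
    | zero =>
      rw [card_dominatedPairs_succ_zero, e, Nat.choose_add_two_add_two,
        show N + 1 + 0 + 1 = N + 2 by ring, Nat.choose_add_two_add_two,
        Nat.choose_symm_half N |>.symm]
      have h0 := ih (a + 1) 0
      have h1 := ih (a + 1) 1
      simp only [Nat.add_zero, Nat.add_assoc, Nat.reduceAdd] at h0 h1 ⊢
      omega
    | succ h =>
      rw [card_dominatedPairs_succ_succ, e, Nat.choose_add_two_add_two,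
        show N + 1 + (h + 1) + 1 = N + h + 1 + 2 by ring, Nat.choose_add_two_add_two]
      have h0 := ih (a + 1) h
      have h1 := ih (a + 1) (h + 1)
      have h2 := ih (a + 1) (h + 2)
      rw [show N + 1 + (h + 1) = N + h + 2 by ring]
      simp only [← Nat.add_assoc] at h0 h1 h2 ⊢
      rw [show N + h + 1 + 1 = N + h + 2 by ring, show N + h + 1 + 2 = N + h + 3 by ring] at *
      rw [show N + h + 2 + 1 = N + h + 3 by ring, show N + h + 2 + 2 = N + h + 4 by ring] at *
      omega

theorem card_dominatedPairs_zero (N a : ℕ) :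
    (dominatedPairs N a 0).card = catalanNum (N + 1) := by
  have h1 := card_dominatedPairs_add N a 0
  have h2 := Nat.choose_succ_right_eq (2 * N + 1) (N + 1)
  have h3 : (2 * (N + 1)).choose (N + 1) = 2 * (2 * N + 1).choose (N + 1) := by
    rw [show 2 * (N + 1) = 2 * N + 1 + 1 by ring, Nat.choose_succ_succ', ← Nat.choose_symm_half]
    ring
  rw [show 2 * N + 1 - (N + 1) = N by omega] at h2
  symm
  rw [catalanNum, h3]
  refine Nat.div_eq_of_eq_mul_left (by omega) ?_
  simp only [Nat.add_zero, Nat.add_assoc, Nat.reduceAdd] at h1 h2 ⊢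
  nlinarith

theorem length_le_of_pairwise_lt {l : List ℕ} {N : ℕ} (hl : l.Pairwise (· < ·))
    (hb : ∀ i ∈ l, 1 ≤ i ∧ i ≤ N) : l.length ≤ N := by
  have hnd : l.Nodup := hl.imp fun h => h.ne
  rw [← List.toFinset_card_of_nodup hnd]
  refine (Finset.card_le_card (t := Finset.Icc 1 N) fun i hi => ?_).trans (by simp)
  exact Finset.mem_Icc.2 (hb i (List.mem_toFinset.1 hi))

/-- For `d ≥ 2`, `n ≥ 2`, the number of tuples `(p,k,(i_1,…,i_p),(j_1,…,j_p))` with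
`1 ≤ p ≤ n−1`, `1 ≤ k ≤ d−1`, `1 ≤ i_1 < ⋯ < i_p ≤ n−1`, `1 ≤ j_1 < ⋯ < j_p ≤ n−1`
and `i_m ≥ j_m` for all `m`, equals `(d−1)·(C_n − 1)`. -/
theorem card_type_III_monomials (d n : ℕ) (hd : 2 ≤ d) (hn : 2 ≤ n) :
    Nat.card {x : ℕ × List ℕ × List ℕ //
      1 ≤ x.1 ∧ x.1 ≤ d - 1 ∧
      1 ≤ x.2.1.length ∧ x.2.1.length ≤ n - 1 ∧ x.2.1.length = x.2.2.length ∧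
      x.2.1.Chain' (· < ·) ∧ x.2.2.Chain' (· < ·) ∧
      (∀ i ∈ x.2.1, 1 ≤ i ∧ i ≤ n - 1) ∧ (∀ j ∈ x.2.2, 1 ≤ j ∧ j ≤ n - 1) ∧
      (∀ (m : ℕ) (h1 : m < x.2.1.length) (h2 : m < x.2.2.length),
        x.2.2.get ⟨m, h2⟩ ≤ x.2.1.get ⟨m, h1⟩)} =
    (d - 1) * (catalanNum n - 1) := by
  obtain ⟨N, rfl⟩ : ∃ N, n = N + 1 := ⟨n - 1, by omega⟩
  have hnil : (([], []) : List ℕ × List ℕ) ∈ dominatedPairs N 1 0 :=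
    mem_dominatedPairs.2 (by simp [IsDominatedPair])
  rw [← card_dominatedPairs_zero N 1, ← Finset.card_erase_of_mem hnil]
  have hc : d - 1 = (Finset.Icc 1 (d - 1)).card := by simp
  conv_rhs => rw [hc, ← Finset.card_product]
  refine Nat.subtype_card _ ?_
  rintro ⟨k, I, J⟩
  simp only [Finset.mem_product, Finset.mem_Icc, Finset.mem_erase, mem_dominatedPairs,
    IsDominatedPair, List.Chain', List.isChain_iff_pairwise, List.get_eq_getElem,
    Nat.add_sub_cancel, Nat.add_zero, ne_eq, Prod.mk.injEq]
  constructor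
  · rintro ⟨⟨hk1, hk2⟩, hne, hI, hJ, bI, bJ, hl, hd⟩
    have bI' : ∀ i ∈ I, 1 ≤ i ∧ i ≤ N := fun i hi => by have := bI i hi; omega
    refine ⟨hk1, hk2, ?_, length_le_of_pairwise_lt hI bI', hl, hI, hJ, bI',
      fun j hj => by have := bJ j hj; omega, fun m h1 h2 => hd m h2 h1⟩
    by_contra! h0
    exact hne ⟨List.length_eq_zero_iff.1 (by omega), List.length_eq_zero_iff.1 (by omega)⟩
  · rintro ⟨hk1, hk2, h1, -, hl, hI, hJ, bI, bJ, hd⟩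
    refine ⟨⟨hk1, hk2⟩, ?_, hI, hJ, fun i hi => by have := bI i hi; omega,
      fun j hj => by have := bJ j hj; omega, hl, fun m h2 h1 => hd m h1 h2⟩
    rintro ⟨rfl, -⟩
    simp at h1
end
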